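/- Let ω₁ ∈ [0,1]. The matrix B_F(ω₁) tightly circumscribes V(𝒜) if and only if there exists x ∈ ℝᵈ with x ≠ 0 such that g(x) = xᵀ A_F(ω₁) x. -/

import Mathlib

open Matrix Set

noncomputable section

/-- `H = [I_d; I_d]`, the two vertically stacked `d×d` identity blocks. -/
def Hmat (d : ℕ) : Matrix (Fin d ⊕ Fin d) (Fin d) ℝ :=
  Matrix.fromRows 1 1

/-- The admissible set `𝒜`: all matrices `P⁽¹⁾ + S` with `P⁽¹⁾` positive
semidefinite with diagonal blocks `P₁` and `P₂`. -/
def Adm (d : ℕ) (P₁ P₂ : Matrix (Fin d) (Fin d) ℝ)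
    (S : Matrix (Fin d ⊕ Fin d) (Fin d ⊕ Fin d) ℝ) :
    Set (Matrix (Fin d ⊕ Fin d) (Fin d ⊕ Fin d) ℝ) :=
  {P | ∃ Q : Matrix (Fin d ⊕ Fin d) (Fin d ⊕ Fin d) ℝ,
      Q.PosSemidef ∧ Q.toBlocks₁₁ = P₁ ∧ Q.toBlocks₂₂ = P₂ ∧ P = Q + S}

/-- The ESCI centralized bound `Bc(ω) = blockdiag(ω⁻¹ P₁, (1-ω)⁻¹ P₂) + S`. -/
def Bc (d : ℕ) (P₁ P₂ : Matrix (Fin d) (Fin d) ℝ)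
    (S : Matrix (Fin d ⊕ Fin d) (Fin d ⊕ Fin d) ℝ) (ω : ℝ) :
    Matrix (Fin d ⊕ Fin d) (Fin d ⊕ Fin d) ℝ :=
  Matrix.fromBlocks (ω⁻¹ • P₁) 0 0 ((1 - ω)⁻¹ • P₂) + S

/-- The fused ESCI precision matrix `A_F(ω) = Hᵀ Bc(ω)⁻¹ H`, continuously
extended at the endpoints. -/
def AF (d : ℕ) (P₁ P₂ : Matrix (Fin d) (Fin d) ℝ)
    (S : Matrix (Fin d ⊕ Fin d) (Fin d ⊕ Fin d) ℝ) (ω : ℝ) :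
    Matrix (Fin d) (Fin d) ℝ :=
  if ω = 0 then (P₂ + S.toBlocks₂₂)⁻¹
  else if ω = 1 then (P₁ + S.toBlocks₁₁)⁻¹
  else (Hmat d)ᵀ * (Bc d P₁ P₂ S ω)⁻¹ * Hmat d

/-- The fused ESCI bound `B_F(ω) = A_F(ω)⁻¹`. -/
def BF (d : ℕ) (P₁ P₂ : Matrix (Fin d) (Fin d) ℝ)
    (S : Matrix (Fin d ⊕ Fin d) (Fin d ⊕ Fin d) ℝ) (ω : ℝ) :
    Matrix (Fin d) (Fin d) ℝ :=
  (AF d P₁ P₂ S ω)⁻¹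

/-- `g(x) = inf_{P ∈ 𝒜} xᵀ Hᵀ P⁻¹ H x`. -/
def gfun (d : ℕ) (P₁ P₂ : Matrix (Fin d) (Fin d) ℝ)
    (S : Matrix (Fin d ⊕ Fin d) (Fin d ⊕ Fin d) ℝ) (x : Fin d → ℝ) : ℝ :=
  ⨅ P : (Adm d P₁ P₂ S),
    x ⬝ᵥ ((Hmat d)ᵀ * ((P : Matrix (Fin d ⊕ Fin d) (Fin d ⊕ Fin d) ℝ))⁻¹ * Hmat d) *ᵥ x

/-- `h_x(ω) = xᵀ A_F(ω) x`. -/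
def hfun (d : ℕ) (P₁ P₂ : Matrix (Fin d) (Fin d) ℝ)
    (S : Matrix (Fin d ⊕ Fin d) (Fin d ⊕ Fin d) ℝ) (x : Fin d → ℝ) (ω : ℝ) : ℝ :=
  x ⬝ᵥ (AF d P₁ P₂ S ω) *ᵥ x

/-- `B` tightly circumscribes `V(𝒜)`: `B` is positive definite, the ellipsoid of
`B` contains `V(𝒜)` (i.e. `xᵀ B⁻¹ x ≤ g(x)` for all `x`), and no smaller
ellipsoid does. -/
def TightlyCircumscribes (d : ℕ) (P₁ P₂ : Matrix (Fin d) (Fin d) ℝ)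
    (S : Matrix (Fin d ⊕ Fin d) (Fin d ⊕ Fin d) ℝ)
    (B : Matrix (Fin d) (Fin d) ℝ) : Prop :=
  B.PosDef ∧ (∀ x : Fin d → ℝ, x ⬝ᵥ B⁻¹ *ᵥ x ≤ gfun d P₁ P₂ S x) ∧
    ∀ Q : Matrix (Fin d) (Fin d) ℝ, Q.PosDef →
      (∀ x : Fin d → ℝ, x ⬝ᵥ Q⁻¹ *ᵥ x ≤ gfun d P₁ P₂ S x) →
      (B - Q).PosSemidef → Q = B

namespace Matrix

variable {m n : Type*} [Fintype m] [Fintype n]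

theorem IsHermitian.dotProduct_mulVec_comm_real {A : Matrix n n ℝ} (hA : A.IsHermitian)
    (v w : n → ℝ) : v ⬝ᵥ A *ᵥ w = w ⬝ᵥ A *ᵥ v := by
  have hT : Aᵀ = A := by simpa [IsHermitian, conjTranspose_eq_transpose_of_trivial] using hA
  rw [dotProduct_mulVec, ← mulVec_transpose, hT, dotProduct_comm]

theorem PosSemidef.nonneg_real {A : Matrix n n ℝ} (hA : A.PosSemidef) (v : n → ℝ) :
    0 ≤ v ⬝ᵥ A *ᵥ v := by
  simpa using hA.dotProduct_mulVec_nonneg v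

theorem PosDef.pos_real {A : Matrix n n ℝ} (hA : A.PosDef) {v : n → ℝ} (hv : v ≠ 0) :
    0 < v ⬝ᵥ A *ᵥ v := by
  simpa using hA.dotProduct_mulVec_pos hv

/-- The quadratic form of a matrix expanded along a line. -/
theorem dotProduct_mulVec_add_smul (A : Matrix n n ℝ) (v w : n → ℝ) (t : ℝ) :
    (v + t • w) ⬝ᵥ A *ᵥ (v + t • w) =
      v ⬝ᵥ A *ᵥ v + t * (v ⬝ᵥ A *ᵥ w + w ⬝ᵥ A *ᵥ v) + t ^ 2 * (w ⬝ᵥ A *ᵥ w) := by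
  simp only [mulVec_add, mulVec_smul, add_dotProduct, dotProduct_add, smul_dotProduct,
    dotProduct_smul, smul_eq_mul]
  ring

/-- A quadratic form with positive semidefinite matrix is convex. -/
theorem PosSemidef.dotProduct_mulVec_convex {A : Matrix n n ℝ} (hA : A.PosSemidef)
    (v w : n → ℝ) {s : ℝ} (hs₀ : 0 ≤ s) (hs₁ : s ≤ 1) :
    (s • v + (1 - s) • w) ⬝ᵥ A *ᵥ (s • v + (1 - s) • w) ≤
      s * (v ⬝ᵥ A *ᵥ v) + (1 - s) * (w ⬝ᵥ A *ᵥ w) := by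
  have h := hA.nonneg_real (v - w)
  simp only [mulVec_add, mulVec_sub, mulVec_smul, add_dotProduct, dotProduct_add, sub_dotProduct,
    dotProduct_sub, smul_dotProduct, dotProduct_smul, smul_eq_mul] at h ⊢
  nlinarith [mul_nonneg (mul_nonneg hs₀ (sub_nonneg.2 hs₁)) h]

theorem PosSemidef.sq_dotProduct_mulVec_le {A : Matrix n n ℝ} (hA : A.PosSemidef)
    (v w : n → ℝ) : (v ⬝ᵥ A *ᵥ w) ^ 2 ≤ (v ⬝ᵥ A *ᵥ v) * (w ⬝ᵥ A *ᵥ w) := by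
  have h (t : ℝ) : 0 ≤ (w ⬝ᵥ A *ᵥ w) * (t * t) + (2 * (v ⬝ᵥ A *ᵥ w)) * t + v ⬝ᵥ A *ᵥ v := by
    have h := hA.nonneg_real (v + t • w)
    rw [dotProduct_mulVec_add_smul, hA.1.dotProduct_mulVec_comm_real w v] at h
    linarith
  have := discrim_le_zero h
  simp only [discrim] at this
  linarith

theorem PosDef.fromBlocks_diagonal {A : Matrix m m ℝ} {B : Matrix n n ℝ} (hA : A.PosDef)
    (hB : B.PosDef) : (fromBlocks A 0 0 B).PosDef := by
  refine .of_dotProduct_mulVec_pos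
    (IsHermitian.fromBlocks hA.1 (by simp) hB.1) fun {x} hx => ?_
  obtain ⟨a, b, rfl⟩ : ∃ a b, x = Sum.elim a b := ⟨_, _, (Sum.elim_comp_inl_inr x).symm⟩
  simp only [star_trivial, fromBlocks_mulVec, sumElim_dotProduct_sumElim, Sum.elim_comp_inl,
    Sum.elim_comp_inr, zero_mulVec, add_zero, zero_add]
  by_cases ha : a = 0
  · have hb : b ≠ 0 := by
      rintro rfl
      exact hx (by rw [ha]; exact Sum.elim_zero_zero)
    exact add_pos_of_nonneg_of_pos (hA.posSemidef.nonneg_real a) (hB.pos_real hb)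
  · exact add_pos_of_pos_of_nonneg (hA.pos_real ha) (hB.posSemidef.nonneg_real b)

/-- On a finite-dimensional space, continuous functions that are homogeneous of degree two are
dominated by any positive one. -/
theorem exists_pos_forall_le_mul_of_homogeneous {φ ψ : (n → ℝ) → ℝ} (hφ : Continuous φ)
    (hψ : Continuous ψ) (hφs : ∀ (t : ℝ) x, φ (t • x) = t ^ 2 * φ x)
    (hψs : ∀ (t : ℝ) x, ψ (t • x) = t ^ 2 * ψ x) (hpos : ∀ x, x ≠ 0 → 0 < φ x) :
    ∃ C : ℝ, 0 < C ∧ ∀ x, ψ x ≤ C * φ x := by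
  have hne {x : n → ℝ} (hx : x ∈ Metric.sphere (0 : n → ℝ) 1) : x ≠ 0 :=
    ne_zero_of_mem_unit_sphere ⟨x, hx⟩
  obtain ⟨C, hC⟩ := (isCompact_sphere (0 : n → ℝ) 1).bddAbove_image
    (hψ.continuousOn.div hφ.continuousOn fun x hx => (hpos x (hne hx)).ne')
  refine ⟨max C 1, by positivity, fun x => ?_⟩
  by_cases hx : x = 0
  · have h₁ := hφs 0 x
    have h₂ := hψs 0 x
    simp only [zero_smul, ne_eq, OfNat.ofNat_ne_zero, not_false_eq_true, zero_pow, zero_mul]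
      at h₁ h₂
    simp [hx, h₁, h₂]
  · have hn : 0 < ‖x‖ := norm_pos_iff.2 hx
    have hmem : ‖x‖⁻¹ • x ∈ Metric.sphere (0 : n → ℝ) 1 := by
      simp [norm_smul, hn.ne']
    have h := hC (Set.mem_image_of_mem _ hmem)
    have hp := hpos x hx
    simp only [Pi.div_apply, hφs, hψs] at h
    rw [mul_div_mul_left _ _ (by positivity), div_le_iff₀ hp] at h
    exact h.trans (mul_le_mul_of_nonneg_right (le_max_left _ _) hp.le)

variable [DecidableEq m] [DecidableEq n]

theorem PosDef.mulVec_inv_mulVec {A : Matrix n n ℝ} (hA : A.PosDef) (v : n → ℝ) :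
    A *ᵥ A⁻¹ *ᵥ v = v := by
  rw [mulVec_mulVec, mul_nonsing_inv _ ((isUnit_iff_isUnit_det _).1 hA.isUnit), one_mulVec]

theorem PosDef.inv_mulVec_mulVec {A : Matrix n n ℝ} (hA : A.PosDef) (v : n → ℝ) :
    A⁻¹ *ᵥ A *ᵥ v = v := by
  rw [mulVec_mulVec, nonsing_inv_mul _ ((isUnit_iff_isUnit_det _).1 hA.isUnit), one_mulVec]

theorem PosDef.inv_inv {A : Matrix n n ℝ} (hA : A.PosDef) : A⁻¹⁻¹ = A :=
  nonsing_inv_nonsing_inv _ ((isUnit_iff_isUnit_det _).1 hA.isUnit)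

/-- The variational lower bound for the quadratic form of an inverse. -/
theorem PosDef.two_mul_dotProduct_sub_le_inv {A : Matrix n n ℝ} (hA : A.PosDef) (y z : n → ℝ) :
    2 * (z ⬝ᵥ y) - z ⬝ᵥ A *ᵥ z ≤ y ⬝ᵥ A⁻¹ *ᵥ y := by
  have h := hA.posSemidef.nonneg_real (A⁻¹ *ᵥ y - z)
  simp only [mulVec_sub, sub_dotProduct, dotProduct_sub, hA.mulVec_inv_mulVec] at h
  have h₁ := hA.1.dotProduct_mulVec_comm_real (A⁻¹ *ᵥ y) z
  rw [hA.mulVec_inv_mulVec] at h₁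
  rw [h₁, dotProduct_comm (A⁻¹ *ᵥ y) y] at h
  linarith

/-- Matrix inversion is antitone on positive definite matrices. -/
theorem PosDef.inv_sub_inv_posSemidef {A B : Matrix n n ℝ} (hA : A.PosDef) (hB : B.PosDef)
    (hAB : (B - A).PosSemidef) : (A⁻¹ - B⁻¹).PosSemidef := by
  refine .of_dotProduct_mulVec_nonneg (hA.inv.1.sub hB.inv.1) fun y => ?_
  have h₁ := hA.two_mul_dotProduct_sub_le_inv y (B⁻¹ *ᵥ y)
  have h₂ := hAB.nonneg_real (B⁻¹ *ᵥ y)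
  simp only [sub_mulVec, dotProduct_sub, hB.mulVec_inv_mulVec, star_trivial] at h₂ ⊢
  rw [dotProduct_comm (B⁻¹ *ᵥ y) y] at h₁ h₂
  linarith

theorem PosSemidef.eq_zero_of_forall_dotProduct_mulVec_eq_zero {A : Matrix n n ℝ}
    (hA : A.PosSemidef) (h : ∀ v, v ⬝ᵥ A *ᵥ v = 0) : A = 0 := by
  refine ext_of_mulVec_single fun i => ?_
  rw [zero_mulVec]
  exact (hA.dotProduct_mulVec_zero_iff _).1 (by simpa using h (Pi.single i 1))

/-- Two positive definite diagonal blocks together with a rank one off-diagonal block built from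
vectors in their unit ellipsoids form a positive semidefinite matrix. -/
theorem PosDef.fromBlocks_vecMulVec {A : Matrix m m ℝ} {B : Matrix n n ℝ} (hA : A.PosDef)
    (hB : B.PosDef) {a : m → ℝ} {b : n → ℝ} (ha : a ⬝ᵥ A⁻¹ *ᵥ a ≤ 1) (hb : b ⬝ᵥ B⁻¹ *ᵥ b ≤ 1) :
    (fromBlocks A (vecMulVec a b) (vecMulVec b a) B).PosSemidef := by
  refine .of_dotProduct_mulVec_nonneg
    (IsHermitian.fromBlocks hA.1 (by ext; simp [vecMulVec_apply, mul_comm]) hB.1) fun x => ?_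
  obtain ⟨v, w, rfl⟩ : ∃ v w, x = Sum.elim v w := ⟨_, _, (Sum.elim_comp_inl_inr x).symm⟩
  have h₁ := hA.posSemidef.sq_dotProduct_mulVec_le v (A⁻¹ *ᵥ a)
  have h₂ := hB.posSemidef.sq_dotProduct_mulVec_le w (B⁻¹ *ᵥ b)
  rw [hA.mulVec_inv_mulVec, dotProduct_comm (A⁻¹ *ᵥ a)] at h₁
  rw [hB.mulVec_inv_mulVec, dotProduct_comm (B⁻¹ *ᵥ b)] at h₂
  have hv := hA.posSemidef.nonneg_real v
  have hw := hB.posSemidef.nonneg_real w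
  simp only [star_trivial, fromBlocks_mulVec, sumElim_dotProduct_sumElim, Sum.elim_comp_inl,
    Sum.elim_comp_inr, dotProduct_add, vecMulVec_mulVec, dotProduct_smul,
    op_smul_eq_smul, smul_eq_mul, dotProduct_comm b w, dotProduct_comm a v]
  have h₁' : (v ⬝ᵥ a) ^ 2 ≤ v ⬝ᵥ A *ᵥ v := h₁.trans (mul_le_of_le_one_right hv ha)
  have h₂' : (w ⬝ᵥ b) ^ 2 ≤ w ⬝ᵥ B *ᵥ w := h₂.trans (mul_le_of_le_one_right hw hb)
  nlinarith [sq_nonneg (v ⬝ᵥ a + w ⬝ᵥ b)]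

end Matrix

variable {d : ℕ} {P₁ P₂ : Matrix (Fin d) (Fin d) ℝ}
  {S : Matrix (Fin d ⊕ Fin d) (Fin d ⊕ Fin d) ℝ} {ω : ℝ}

theorem Hmat_mulVec (x : Fin d → ℝ) : Hmat d *ᵥ x = Sum.elim x x := by
  simp [Hmat, fromRows_mulVec]

theorem Hmat_mulVec_injective : Function.Injective (Hmat d).mulVec := fun x y h => by
  have h' : Hmat d *ᵥ x = Hmat d *ᵥ y := h
  rw [Hmat_mulVec, Hmat_mulVec] at h'
  exact funext fun i => by simpa using congrFun h' (Sum.inl i)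

theorem dotProduct_Hmat_conj_mulVec (M : Matrix (Fin d ⊕ Fin d) (Fin d ⊕ Fin d) ℝ)
    (x : Fin d → ℝ) :
    x ⬝ᵥ ((Hmat d)ᵀ * M * Hmat d) *ᵥ x = Sum.elim x x ⬝ᵥ M *ᵥ Sum.elim x x := by
  rw [← mulVec_mulVec, ← mulVec_mulVec, dotProduct_mulVec, vecMul_transpose, Hmat_mulVec]

theorem posDef_of_mem_Adm (hS : S.PosDef) {P : Matrix (Fin d ⊕ Fin d) (Fin d ⊕ Fin d) ℝ}
    (hP : P ∈ Adm d P₁ P₂ S) : P.PosDef := by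
  obtain ⟨Q, hQ, -, -, rfl⟩ := hP
  exact hS.posSemidef_add hQ

theorem Adm_nonempty (hP₁ : P₁.PosDef) (hP₂ : P₂.PosDef) : (Adm d P₁ P₂ S).Nonempty :=
  ⟨_, _, (hP₁.fromBlocks_diagonal hP₂).posSemidef, toBlocks_fromBlocks₁₁ ..,
    toBlocks_fromBlocks₂₂ .., rfl⟩

theorem gfun_le_of_mem_Adm (hS : S.PosDef) {P : Matrix (Fin d ⊕ Fin d) (Fin d ⊕ Fin d) ℝ}
    (hP : P ∈ Adm d P₁ P₂ S) (x : Fin d → ℝ) :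
    gfun d P₁ P₂ S x ≤ Sum.elim x x ⬝ᵥ P⁻¹ *ᵥ Sum.elim x x := by
  rw [← dotProduct_Hmat_conj_mulVec]
  refine ciInf_le (f := fun P : Adm d P₁ P₂ S =>
    x ⬝ᵥ ((Hmat d)ᵀ * (P : Matrix (Fin d ⊕ Fin d) (Fin d ⊕ Fin d) ℝ)⁻¹ * Hmat d) *ᵥ x)
    ⟨0, ?_⟩ ⟨P, hP⟩
  rintro _ ⟨R, rfl⟩
  simp only [dotProduct_Hmat_conj_mulVec]
  exact (posDef_of_mem_Adm hS R.2).inv.posSemidef.nonneg_real _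

theorem Bc_posDef (hP₁ : P₁.PosDef) (hP₂ : P₂.PosDef) (hS : S.PosDef) (h₀ : 0 < ω) (h₁ : ω < 1) :
    (Bc d P₁ P₂ S ω).PosDef :=
  ((hP₁.smul (inv_pos.2 h₀)).fromBlocks_diagonal
    (hP₂.smul (inv_pos.2 (sub_pos.2 h₁)))).add hS

theorem add_toBlocks₁₁_posDef (hP₁ : P₁.PosDef) (hS : S.PosDef) :
    (P₁ + S.toBlocks₁₁).PosDef :=
  hP₁.add (hS.submatrix Sum.inl_injective)

theorem add_toBlocks₂₂_posDef (hP₂ : P₂.PosDef) (hS : S.PosDef) :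
    (P₂ + S.toBlocks₂₂).PosDef :=
  hP₂.add (hS.submatrix Sum.inr_injective)

theorem AF_posDef (hP₁ : P₁.PosDef) (hP₂ : P₂.PosDef) (hS : S.PosDef) (hω : ω ∈ Icc (0 : ℝ) 1) :
    (AF d P₁ P₂ S ω).PosDef := by
  unfold AF
  split_ifs with h₀ h₁
  · exact (add_toBlocks₂₂_posDef hP₂ hS).inv
  · exact (add_toBlocks₁₁_posDef hP₁ hS).inv
  · have hB := Bc_posDef hP₁ hP₂ hS (lt_of_le_of_ne hω.1 (Ne.symm h₀)) (lt_of_le_of_ne hω.2 h₁)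
    simpa [conjTranspose_eq_transpose_of_trivial] using
      hB.inv.conjTranspose_mul_mul_same Hmat_mulVec_injective

/-- `A_F(ω)` in terms of vectors `u` linear in `x` that solve `u + S D u = H x`, where
`D = blockdiag(ω P₁⁻¹, (1 - ω) P₂⁻¹)`; this form is uniform in `ω ∈ [0, 1]`. -/
theorem exists_AF_representation (hP₁ : P₁.PosDef) (hP₂ : P₂.PosDef) (hS : S.PosDef)
    (hω : ω ∈ Icc (0 : ℝ) 1) :
    ∃ U₁ U₂ : Matrix (Fin d) (Fin d) ℝ, ∀ x : Fin d → ℝ,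
      Sum.elim (U₁ *ᵥ x) (U₂ *ᵥ x) +
          S *ᵥ Sum.elim (ω • P₁⁻¹ *ᵥ U₁ *ᵥ x) ((1 - ω) • P₂⁻¹ *ᵥ U₂ *ᵥ x) = Sum.elim x x ∧
      x ⬝ᵥ AF d P₁ P₂ S ω *ᵥ x =
        Sum.elim x x ⬝ᵥ Sum.elim (ω • P₁⁻¹ *ᵥ U₁ *ᵥ x) ((1 - ω) • P₂⁻¹ *ᵥ U₂ *ᵥ x) := by
  by_cases h₀ : ω = 0
  · subst h₀
    have hB := add_toBlocks₂₂_posDef hP₂ hS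
    refine ⟨1 - S.toBlocks₁₂ * (P₂ + S.toBlocks₂₂)⁻¹, P₂ * (P₂ + S.toBlocks₂₂)⁻¹, fun x => ?_⟩
    have hx := hB.mulVec_inv_mulVec x
    simp only [← mulVec_mulVec, hP₂.inv_mulVec_mulVec, zero_smul, sub_zero, one_smul, sub_mulVec,
      one_mulVec, AF, if_true, sumElim_dotProduct_sumElim, dotProduct_zero, zero_add, and_true]
    conv_lhs => rw [← fromBlocks_toBlocks S]
    rw [add_mulVec] at hx
    simp only [fromBlocks_mulVec, Sum.elim_comp_inl, Sum.elim_comp_inr, toBlocks_fromBlocks₁₂,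
      toBlocks_fromBlocks₂₂, mulVec_zero, zero_add, ← Sum.elim_add_add, sub_add_cancel, hx]
  by_cases h₁ : ω = 1
  · subst h₁
    have hB := add_toBlocks₁₁_posDef hP₁ hS
    refine ⟨P₁ * (P₁ + S.toBlocks₁₁)⁻¹, 1 - S.toBlocks₂₁ * (P₁ + S.toBlocks₁₁)⁻¹, fun x => ?_⟩
    have hx := hB.mulVec_inv_mulVec x
    simp only [← mulVec_mulVec, hP₁.inv_mulVec_mulVec, zero_smul, sub_self, one_smul, sub_mulVec,
      one_mulVec, AF, if_true, one_ne_zero, if_false, sumElim_dotProduct_sumElim, dotProduct_zero,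
      add_zero, and_true]
    conv_lhs => rw [← fromBlocks_toBlocks S]
    rw [add_mulVec] at hx
    simp only [fromBlocks_mulVec, Sum.elim_comp_inl, Sum.elim_comp_inr, toBlocks_fromBlocks₁₁,
      toBlocks_fromBlocks₂₁, mulVec_zero, add_zero, ← Sum.elim_add_add, sub_add_cancel, hx]
  have h₁' : 1 - ω ≠ 0 := sub_ne_zero.2 (Ne.symm h₁)
  have hB := Bc_posDef hP₁ hP₂ hS (lt_of_le_of_ne hω.1 (Ne.symm h₀)) (lt_of_le_of_ne hω.2 h₁)
  set Z := (Bc d P₁ P₂ S ω)⁻¹ * Hmat d with hZ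
  refine ⟨ω⁻¹ • P₁ * Z.toRows₁, (1 - ω)⁻¹ • P₂ * Z.toRows₂, fun x => ?_⟩
  have hZx : Sum.elim (Z.toRows₁ *ᵥ x) (Z.toRows₂ *ᵥ x) =
      (Bc d P₁ P₂ S ω)⁻¹ *ᵥ Sum.elim x x := by
    rw [← fromRows_mulVec, fromRows_toRows, hZ, ← mulVec_mulVec, Hmat_mulVec]
  simp only [← mulVec_mulVec, smul_mulVec, mulVec_smul, hP₁.inv_mulVec_mulVec,
    hP₂.inv_mulVec_mulVec, smul_smul, mul_inv_cancel₀ h₀, mul_inv_cancel₀ h₁', one_smul]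
  constructor
  · have hx := hB.mulVec_inv_mulVec (Sum.elim x x)
    rw [← hZx, Bc, add_mulVec] at hx
    rw [← hx]
    simp [fromBlocks_mulVec, smul_mulVec]
  · rw [hZx, AF, if_neg h₀, if_neg h₁, dotProduct_Hmat_conj_mulVec]

/-- Weak duality, evaluated at the multiplier `ω + δ`. -/
theorem le_gfun (hP₁ : P₁.PosDef) (hP₂ : P₂.PosDef) (hS : S.PosDef) {δ : ℝ}
    (hδ : ω + δ ∈ Icc (0 : ℝ) 1) {x u₁ u₂ : Fin d → ℝ}
    (hu : Sum.elim u₁ u₂ + S *ᵥ Sum.elim (ω • P₁⁻¹ *ᵥ u₁) ((1 - ω) • P₂⁻¹ *ᵥ u₂) =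
      Sum.elim x x) :
    Sum.elim x x ⬝ᵥ Sum.elim (ω • P₁⁻¹ *ᵥ u₁) ((1 - ω) • P₂⁻¹ *ᵥ u₂) +
        δ * (u₁ ⬝ᵥ P₁⁻¹ *ᵥ u₁ - u₂ ⬝ᵥ P₂⁻¹ *ᵥ u₂) -
        δ ^ 2 * (Sum.elim (P₁⁻¹ *ᵥ u₁) (-(P₂⁻¹ *ᵥ u₂)) ⬝ᵥ
          S *ᵥ Sum.elim (P₁⁻¹ *ᵥ u₁) (-(P₂⁻¹ *ᵥ u₂))) ≤ gfun d P₁ P₂ S x := by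
  have := (Adm_nonempty (S := S) hP₁ hP₂).to_subtype
  refine le_ciInf fun ⟨P, hP⟩ => ?_
  have hPd := posDef_of_mem_Adm hS hP
  obtain ⟨Q, hQ, hQ₁, hQ₂, rfl⟩ := hP
  rw [dotProduct_Hmat_conj_mulVec]
  set z : Fin d ⊕ Fin d → ℝ := Sum.elim (ω • P₁⁻¹ *ᵥ u₁) ((1 - ω) • P₂⁻¹ *ᵥ u₂) with hz
  set e : Fin d ⊕ Fin d → ℝ := Sum.elim (P₁⁻¹ *ᵥ u₁) (-(P₂⁻¹ *ᵥ u₂)) with he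
  have hlow := hPd.two_mul_dotProduct_sub_le_inv (Sum.elim x x) (z + δ • e)
  have hconv := hQ.dotProduct_mulVec_convex (Sum.elim (P₁⁻¹ *ᵥ u₁) 0) (Sum.elim 0 (P₂⁻¹ *ᵥ u₂))
    hδ.1 hδ.2
  have hsplit : (ω + δ) • (Sum.elim (P₁⁻¹ *ᵥ u₁) 0 : Fin d ⊕ Fin d → ℝ) +
      (1 - (ω + δ)) • (Sum.elim 0 (P₂⁻¹ *ᵥ u₂) : Fin d ⊕ Fin d → ℝ) = z + δ • e := by
    ext (i | i) <;> simp [hz, he] <;> ring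
  have hq₁ : (Sum.elim (P₁⁻¹ *ᵥ u₁) 0 : Fin d ⊕ Fin d → ℝ) ⬝ᵥ Q *ᵥ Sum.elim (P₁⁻¹ *ᵥ u₁) 0 =
      u₁ ⬝ᵥ P₁⁻¹ *ᵥ u₁ := by
    rw [← fromBlocks_toBlocks Q, fromBlocks_mulVec, hQ₁]
    simp [sumElim_dotProduct_sumElim, hP₁.mulVec_inv_mulVec, dotProduct_comm]
  have hq₂ : (Sum.elim 0 (P₂⁻¹ *ᵥ u₂) : Fin d ⊕ Fin d → ℝ) ⬝ᵥ Q *ᵥ Sum.elim 0 (P₂⁻¹ *ᵥ u₂) =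
      u₂ ⬝ᵥ P₂⁻¹ *ᵥ u₂ := by
    rw [← fromBlocks_toBlocks Q, fromBlocks_mulVec, hQ₂]
    simp [sumElim_dotProduct_sumElim, hP₂.mulVec_inv_mulVec, dotProduct_comm]
  have hzu : z ⬝ᵥ Sum.elim u₁ u₂ =
      ω * (u₁ ⬝ᵥ P₁⁻¹ *ᵥ u₁) + (1 - ω) * (u₂ ⬝ᵥ P₂⁻¹ *ᵥ u₂) := by
    rw [hz, sumElim_dotProduct_sumElim, smul_dotProduct, smul_dotProduct, smul_eq_mul,
      smul_eq_mul, dotProduct_comm _ u₁, dotProduct_comm _ u₂]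
  have heu : e ⬝ᵥ Sum.elim u₁ u₂ = u₁ ⬝ᵥ P₁⁻¹ *ᵥ u₁ - u₂ ⬝ᵥ P₂⁻¹ *ᵥ u₂ := by
    rw [he, sumElim_dotProduct_sumElim, neg_dotProduct, dotProduct_comm _ u₁,
      dotProduct_comm _ u₂, sub_eq_add_neg]
  rw [hsplit, hq₁, hq₂] at hconv
  refine le_trans ?_ hlow
  rw [add_mulVec, dotProduct_add, dotProduct_mulVec_add_smul S,
    hS.1.dotProduct_mulVec_comm_real e z, ← hu]
  rw [hS.1.dotProduct_mulVec_comm_real z e]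
  generalize (z + δ • e) ⬝ᵥ Q *ᵥ (z + δ • e) = q at hconv ⊢
  simp only [add_dotProduct, dotProduct_add, smul_dotProduct, smul_eq_mul, hzu, heu,
    dotProduct_comm (Sum.elim u₁ u₂) z, dotProduct_comm (S *ᵥ z) z]
  linarith

/-- An upper bound for `g` from the admissible matrix with rank one off-diagonal block. -/
theorem gfun_le (hP₁ : P₁.PosDef) (hP₂ : P₂.PosDef) (hS : S.PosDef)
    {x u₁ u₂ n₁ n₂ : Fin d → ℝ} {z : Fin d ⊕ Fin d → ℝ}
    (hz : z = Sum.elim (ω • P₁⁻¹ *ᵥ u₁) ((1 - ω) • P₂⁻¹ *ᵥ u₂))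
    (hu : Sum.elim u₁ u₂ + S *ᵥ z = Sum.elim x x)
    (hn₁ : n₁ ⬝ᵥ P₁⁻¹ *ᵥ n₁ ≤ 1) (hn₂ : n₂ ⬝ᵥ P₂⁻¹ *ᵥ n₂ ≤ 1) {e : Fin d ⊕ Fin d → ℝ}
    (he : e = Sum.elim ((1 - ω) • ((n₂ ⬝ᵥ P₂⁻¹ *ᵥ u₂) • n₁ - u₁))
      (ω • ((n₁ ⬝ᵥ P₁⁻¹ *ᵥ u₁) • n₂ - u₂))) :
    gfun d P₁ P₂ S x ≤ Sum.elim x x ⬝ᵥ z - z ⬝ᵥ e + e ⬝ᵥ S⁻¹ *ᵥ e := by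
  have hQ := hP₁.fromBlocks_vecMulVec hP₂ hn₁ hn₂
  set Q := fromBlocks P₁ (vecMulVec n₁ n₂) (vecMulVec n₂ n₁) P₂ with hQdef
  have hmem : Q + S ∈ Adm d P₁ P₂ S :=
    ⟨Q, hQ, toBlocks_fromBlocks₁₁ .., toBlocks_fromBlocks₂₂ .., rfl⟩
  have hPd := posDef_of_mem_Adm hS hmem
  have hPz : (Q + S) *ᵥ z - e = Sum.elim x x := by
    have hQz : Q *ᵥ z = Sum.elim u₁ u₂ + e := by
      rw [hQdef, hz, fromBlocks_mulVec, he]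
      simp only [Sum.elim_comp_inl, Sum.elim_comp_inr, mulVec_smul, hP₁.mulVec_inv_mulVec,
        hP₂.mulVec_inv_mulVec, vecMulVec_mulVec, op_smul_eq_smul]
      ext (i | i) <;> simp <;> ring
    rw [add_mulVec, hQz, ← hu]
    abel
  have hinv := (hS.inv_sub_inv_posSemidef hPd (by simpa using hQ)).nonneg_real e
  rw [sub_mulVec, dotProduct_sub] at hinv
  have hcross : ((Q + S) *ᵥ z) ⬝ᵥ (Q + S)⁻¹ *ᵥ e = z ⬝ᵥ e := by
    rw [hPd.inv.1.dotProduct_mulVec_comm_real, hPd.inv_mulVec_mulVec, dotProduct_comm]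
  refine (gfun_le_of_mem_Adm hS hmem x).trans ?_
  have hexp : Sum.elim x x ⬝ᵥ (Q + S)⁻¹ *ᵥ Sum.elim x x =
      Sum.elim x x ⬝ᵥ z - z ⬝ᵥ e + e ⬝ᵥ (Q + S)⁻¹ *ᵥ e := by
    rw [← hPz, mulVec_sub, hPd.inv_mulVec_mulVec]
    simp only [sub_dotProduct, dotProduct_sub, hcross, dotProduct_comm e z]
    ring
  rw [hexp]
  linarith

theorem inv_sqrt_smul_dotProduct_mulVec_le_one (A : Matrix (Fin d) (Fin d) ℝ) {u : Fin d → ℝ}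
    {b : ℝ} (hb : 0 ≤ b) (h : u ⬝ᵥ A *ᵥ u ≤ b) :
    ((√b)⁻¹ • u) ⬝ᵥ A *ᵥ ((√b)⁻¹ • u) ≤ 1 := by
  rw [mulVec_smul, smul_dotProduct, dotProduct_smul, smul_eq_mul, smul_eq_mul, ← mul_assoc,
    ← mul_inv, Real.mul_self_sqrt hb, inv_mul_eq_div]
  exact div_le_one_of_le₀ h hb

theorem gfun_le_of_zero (hP₁ : P₁.PosDef) (hP₂ : P₂.PosDef) (hS : S.PosDef)
    {x u₁ u₂ : Fin d → ℝ}
    (hu : Sum.elim u₁ u₂ + S *ᵥ Sum.elim ((0 : ℝ) • P₁⁻¹ *ᵥ u₁) ((1 - 0 : ℝ) • P₂⁻¹ *ᵥ u₂) =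
      Sum.elim x x)
    (h : u₁ ⬝ᵥ P₁⁻¹ *ᵥ u₁ ≤ u₂ ⬝ᵥ P₂⁻¹ *ᵥ u₂) :
    gfun d P₁ P₂ S x ≤
      Sum.elim x x ⬝ᵥ Sum.elim ((0 : ℝ) • P₁⁻¹ *ᵥ u₁) ((1 - 0 : ℝ) • P₂⁻¹ *ᵥ u₂) := by
  set b := u₂ ⬝ᵥ P₂⁻¹ *ᵥ u₂ with hb
  have ha₀ := hP₁.inv.posSemidef.nonneg_real u₁
  have hb₀ : 0 ≤ b := hP₂.inv.posSemidef.nonneg_real u₂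
  have hsq : (√b)⁻¹ * (√b)⁻¹ = b⁻¹ := by rw [← mul_inv, Real.mul_self_sqrt hb₀]
  have key := gfun_le hP₁ hP₂ hS rfl hu
    (inv_sqrt_smul_dotProduct_mulVec_le_one _ hb₀ h)
    (inv_sqrt_smul_dotProduct_mulVec_le_one _ hb₀ le_rfl) (e := 0) ?_
  · simpa using key
  · have hu₁ : (b⁻¹ * b) • u₁ = u₁ := by
      by_cases hb' : b = 0
      · have : u₁ = 0 := by
          by_contra hne
          exact absurd (hP₁.inv.pos_real hne) (by linarith)
        simp [this]
      · rw [inv_mul_cancel₀ hb', one_smul]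
    rw [smul_dotProduct, ← hb, smul_eq_mul, smul_smul,
      show (√b)⁻¹ * b * (√b)⁻¹ = b⁻¹ * b by rw [← hsq]; ring, hu₁]
    simp

theorem gfun_le_of_one (hP₁ : P₁.PosDef) (hP₂ : P₂.PosDef) (hS : S.PosDef)
    {x u₁ u₂ : Fin d → ℝ}
    (hu : Sum.elim u₁ u₂ + S *ᵥ Sum.elim ((1 : ℝ) • P₁⁻¹ *ᵥ u₁) ((1 - 1 : ℝ) • P₂⁻¹ *ᵥ u₂) =
      Sum.elim x x)
    (h : u₂ ⬝ᵥ P₂⁻¹ *ᵥ u₂ ≤ u₁ ⬝ᵥ P₁⁻¹ *ᵥ u₁) :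
    gfun d P₁ P₂ S x ≤
      Sum.elim x x ⬝ᵥ Sum.elim ((1 : ℝ) • P₁⁻¹ *ᵥ u₁) ((1 - 1 : ℝ) • P₂⁻¹ *ᵥ u₂) := by
  set b := u₁ ⬝ᵥ P₁⁻¹ *ᵥ u₁ with hb
  have ha₀ := hP₂.inv.posSemidef.nonneg_real u₂
  have hb₀ : 0 ≤ b := hP₁.inv.posSemidef.nonneg_real u₁
  have hsq : (√b)⁻¹ * (√b)⁻¹ = b⁻¹ := by rw [← mul_inv, Real.mul_self_sqrt hb₀]
  have key := gfun_le hP₁ hP₂ hS rfl hu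
    (inv_sqrt_smul_dotProduct_mulVec_le_one _ hb₀ le_rfl)
    (inv_sqrt_smul_dotProduct_mulVec_le_one _ hb₀ h) (e := 0) ?_
  · simpa using key
  · have hu₂ : (b⁻¹ * b) • u₂ = u₂ := by
      by_cases hb' : b = 0
      · have : u₂ = 0 := by
          by_contra hne
          exact absurd (hP₂.inv.pos_real hne) (by linarith)
        simp [this]
      · rw [inv_mul_cancel₀ hb', one_smul]
    rw [smul_dotProduct _ u₁, ← hb, smul_eq_mul, smul_smul _ _ u₂,
      show (√b)⁻¹ * b * (√b)⁻¹ = b⁻¹ * b by rw [← hsq]; ring, hu₂]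
    simp

/-- Every vector is a multiple of one in the unit ellipsoid of a positive definite matrix. -/
theorem Matrix.PosDef.exists_normalised {A : Matrix (Fin d) (Fin d) ℝ} (hA : A.PosDef)
    (u : Fin d → ℝ) : ∃ n : Fin d → ℝ, n ⬝ᵥ A *ᵥ n ≤ 1 ∧ n ⬝ᵥ A *ᵥ u = √(u ⬝ᵥ A *ᵥ u) ∧
      u = √(u ⬝ᵥ A *ᵥ u) • n := by
  by_cases hu : u = 0
  · exact ⟨0, by simp, by simp [hu], by simp [hu]⟩
  · have hpos := hA.pos_real hu
    have hs : √(u ⬝ᵥ A *ᵥ u) ≠ 0 := (Real.sqrt_pos.2 hpos).ne'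
    have hsq := Real.mul_self_sqrt hpos.le
    refine ⟨(√(u ⬝ᵥ A *ᵥ u))⁻¹ • u, le_of_eq ?_, ?_, ?_⟩
    · rw [mulVec_smul, smul_dotProduct, dotProduct_smul, smul_eq_mul, smul_eq_mul]
      field_simp
      rw [Real.sq_sqrt hpos.le]
    · rw [smul_dotProduct, smul_eq_mul]
      field_simp
      rw [Real.sq_sqrt hpos.le]
    · rw [smul_smul, mul_inv_cancel₀ hs, one_smul]

/-- The gap between `g` and the quadratic form of `A_F(ω)` is of second order in the failure of
stationarity. -/
theorem exists_gfun_le_add_mul_sq (hP₁ : P₁.PosDef) (hP₂ : P₂.PosDef) (hS : S.PosDef)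
    (hω : ω ∈ Icc (0 : ℝ) 1) :
    ∃ C : ℝ, 0 < C ∧ ∀ x u₁ u₂ : Fin d → ℝ,
      Sum.elim u₁ u₂ + S *ᵥ Sum.elim (ω • P₁⁻¹ *ᵥ u₁) ((1 - ω) • P₂⁻¹ *ᵥ u₂) = Sum.elim x x →
      gfun d P₁ P₂ S x ≤
        Sum.elim x x ⬝ᵥ Sum.elim (ω • P₁⁻¹ *ᵥ u₁) ((1 - ω) • P₂⁻¹ *ᵥ u₂) +
          C * (√(u₁ ⬝ᵥ P₁⁻¹ *ᵥ u₁) - √(u₂ ⬝ᵥ P₂⁻¹ *ᵥ u₂)) ^ 2 := by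
  have hR := hP₁.inv.fromBlocks_diagonal hP₂.inv
  obtain ⟨C, hC, hCle⟩ := exists_pos_forall_le_mul_of_homogeneous
    (φ := fun w : Fin d ⊕ Fin d → ℝ => w ⬝ᵥ fromBlocks P₁⁻¹ 0 0 P₂⁻¹ *ᵥ w)
    (ψ := fun w => w ⬝ᵥ S⁻¹ *ᵥ w) (by fun_prop) (by fun_prop)
    (fun t x => by simp only [mulVec_smul, smul_dotProduct, dotProduct_smul, smul_eq_mul]; ring)
    (fun t x => by simp only [mulVec_smul, smul_dotProduct, dotProduct_smul, smul_eq_mul]; ring)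
    (fun x hx => hR.pos_real hx)
  refine ⟨1 + C * 2, by positivity, fun x u₁ u₂ hu => ?_⟩
  obtain ⟨n₁, hn₁, hnu₁, hu₁⟩ := hP₁.inv.exists_normalised u₁
  obtain ⟨n₂, hn₂, hnu₂, hu₂⟩ := hP₂.inv.exists_normalised u₂
  set a := √(u₁ ⬝ᵥ P₁⁻¹ *ᵥ u₁)
  set b := √(u₂ ⬝ᵥ P₂⁻¹ *ᵥ u₂)
  clear_value a b
  have key := gfun_le (e := Sum.elim (((1 - ω) * (b - a)) • n₁) ((ω * (a - b)) • n₂))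
    hP₁ hP₂ hS rfl hu hn₁ hn₂ (by
      congr 1
      · rw [hnu₂]; rw [hu₁, ← sub_smul, smul_smul]
      · rw [hnu₁]; rw [hu₂, ← sub_smul, smul_smul])
  have hbound := hCle (Sum.elim (((1 - ω) * (b - a)) • n₁) ((ω * (a - b)) • n₂))
  simp only [fromBlocks_mulVec, sumElim_dotProduct_sumElim, Sum.elim_comp_inl,
    Sum.elim_comp_inr, zero_mulVec, add_zero, zero_add, smul_zero, mulVec_smul, smul_dotProduct,
    dotProduct_smul, smul_eq_mul] at hbound key ⊢
  rw [dotProduct_comm _ n₁, dotProduct_comm _ n₂, hnu₁, hnu₂] at key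
  have hω₀ := hω.1
  have hω₁ := sub_nonneg.2 hω.2
  have hsq := sq_nonneg (a - b)
  have h₁ : (1 - ω) * (b - a) * ((1 - ω) * (b - a) * (n₁ ⬝ᵥ P₁⁻¹ *ᵥ n₁)) ≤ (a - b) ^ 2 := by
    have hp : (1 - ω) ^ 2 ≤ 1 := by nlinarith
    have h₂ : (1 - ω) ^ 2 * (n₁ ⬝ᵥ P₁⁻¹ *ᵥ n₁) ≤ 1 :=
      mul_le_one₀ hp (hP₁.inv.posSemidef.nonneg_real _) hn₁
    nlinarith
  have h₂ : ω * (a - b) * (ω * (a - b) * (n₂ ⬝ᵥ P₂⁻¹ *ᵥ n₂)) ≤ (a - b) ^ 2 := by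
    have hp : ω ^ 2 ≤ 1 := by nlinarith
    have h₂ : ω ^ 2 * (n₂ ⬝ᵥ P₂⁻¹ *ᵥ n₂) ≤ 1 :=
      mul_le_one₀ hp (hP₂.inv.posSemidef.nonneg_real _) hn₂
    nlinarith
  have h₃ := mul_le_mul_of_nonneg_left (add_le_add h₁ h₂) hC.le
  have h₄ : ω * (1 - ω) * (a - b) ^ 2 ≤ 1 * (a - b) ^ 2 :=
    mul_le_mul_of_nonneg_right (by nlinarith) hsq
  nlinarith

theorem exists_le_quadratic {a : ℝ} (ha : 0 < a) (b c K : ℝ) :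
    ∃ t : ℝ, K ≤ c + b * t + a * t ^ 2 := by
  obtain ⟨s, hs₁, hs₂⟩ : ∃ s : ℝ, 1 ≤ s ∧ K - c ≤ a * s :=
    ⟨max 1 ((K - c) / a), le_max_left _ _, by
      rw [mul_comm, ← div_le_iff₀ ha]; exact le_max_right _ _⟩
  have hss : a * s ≤ a * s ^ 2 := mul_le_mul_of_nonneg_left (by nlinarith) ha.le
  rcases le_total 0 b with hb | hb
  · exact ⟨s, by nlinarith [mul_nonneg hb (zero_le_one.trans hs₁)]⟩
  · exact ⟨-s, by nlinarith [mul_nonneg (neg_nonneg.2 hb) (zero_le_one.trans hs₁)]⟩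

/-- A constant `D` bounded in terms of two quadratic polynomials `p` and `q` as below is
nonpositive. -/
theorem nonpos_of_mul_quadratic_le {D C m₀ m₁ m₂ f₀ f₁ f₂ : ℝ} (hf₂ : 0 < f₂)
    (hzero : ∀ t, m₀ + m₁ * t + m₂ * t ^ 2 = 0 → D ≤ 0)
    (hneg : m₂ < 0 → ∀ t, m₀ + m₁ * t + m₂ * t ^ 2 ≤ 0 → D ≤ 0)
    (hpos : 0 < m₂ → ∀ t, 0 ≤ m₀ + m₁ * t + m₂ * t ^ 2 → D ≤ 0)
    (hbound : ∀ t, D * (f₀ + f₁ * t + f₂ * t ^ 2) ≤ C * (m₀ + m₁ * t + m₂ * t ^ 2) ^ 2) :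
    D ≤ 0 := by
  rcases lt_trichotomy m₂ 0 with h | h | h
  · obtain ⟨t, ht⟩ := exists_le_quadratic (neg_pos.2 h) (-m₁) (-m₀) 0
    exact hneg h t (by linarith)
  · subst h
    by_cases hm₁ : m₁ = 0
    · subst hm₁
      by_contra! hD
      obtain ⟨t, ht⟩ := exists_le_quadratic hf₂ f₁ f₀ ((C * m₀ ^ 2 + 1) / D)
      have h₁ := hbound t
      rw [div_le_iff₀' hD] at ht
      simp only [zero_mul, add_zero] at h₁
      linarith
    · exact hzero (-m₀ / m₁) (by field_simp; ring)
  · obtain ⟨t, ht⟩ := exists_le_quadratic h m₁ m₀ 0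
    exact hpos h t ht

/-- First-order conditions for `ω` to be an optimal multiplier at `x` are sufficient for
`g(x) ≤ xᵀ A_F(ω) x`. -/
theorem gfun_le_of_stationary (hP₁ : P₁.PosDef) (hP₂ : P₂.PosDef) (hS : S.PosDef)
    (hω : ω ∈ Icc (0 : ℝ) 1) {x u₁ u₂ : Fin d → ℝ}
    (hu : Sum.elim u₁ u₂ + S *ᵥ Sum.elim (ω • P₁⁻¹ *ᵥ u₁) ((1 - ω) • P₂⁻¹ *ᵥ u₂) =
      Sum.elim x x)
    (hpos : 0 < u₁ ⬝ᵥ P₁⁻¹ *ᵥ u₁ - u₂ ⬝ᵥ P₂⁻¹ *ᵥ u₂ → ω = 1)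
    (hneg : u₁ ⬝ᵥ P₁⁻¹ *ᵥ u₁ - u₂ ⬝ᵥ P₂⁻¹ *ᵥ u₂ < 0 → ω = 0) :
    gfun d P₁ P₂ S x ≤
      Sum.elim x x ⬝ᵥ Sum.elim (ω • P₁⁻¹ *ᵥ u₁) ((1 - ω) • P₂⁻¹ *ᵥ u₂) := by
  rcases lt_trichotomy (u₁ ⬝ᵥ P₁⁻¹ *ᵥ u₁ - u₂ ⬝ᵥ P₂⁻¹ *ᵥ u₂) 0 with h | h | h
  · obtain rfl := hneg h
    exact gfun_le_of_zero hP₁ hP₂ hS hu (by linarith)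
  · obtain ⟨C, -, hC⟩ := exists_gfun_le_add_mul_sq hP₁ hP₂ hS hω
    simpa [sub_eq_zero.1 h] using hC x u₁ u₂ hu
  · obtain rfl := hpos h
    exact gfun_le_of_one hP₁ hP₂ hS hu (by linarith)

/-- First-order conditions for `ω` to be an optimal multiplier at `x` are necessary for
`g(x) ≤ xᵀ A_F(ω) x`. -/
theorem stationary_of_gfun_le (hP₁ : P₁.PosDef) (hP₂ : P₂.PosDef) (hS : S.PosDef)
    (hω : ω ∈ Icc (0 : ℝ) 1) {x u₁ u₂ : Fin d → ℝ}
    (hu : Sum.elim u₁ u₂ + S *ᵥ Sum.elim (ω • P₁⁻¹ *ᵥ u₁) ((1 - ω) • P₂⁻¹ *ᵥ u₂) =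
      Sum.elim x x)
    (hg : gfun d P₁ P₂ S x ≤
      Sum.elim x x ⬝ᵥ Sum.elim (ω • P₁⁻¹ *ᵥ u₁) ((1 - ω) • P₂⁻¹ *ᵥ u₂)) :
    (0 < u₁ ⬝ᵥ P₁⁻¹ *ᵥ u₁ - u₂ ⬝ᵥ P₂⁻¹ *ᵥ u₂ → ω = 1) ∧
      (u₁ ⬝ᵥ P₁⁻¹ *ᵥ u₁ - u₂ ⬝ᵥ P₂⁻¹ *ᵥ u₂ < 0 → ω = 0) := by
  have hlow (δ : ℝ) (hδ : ω + δ ∈ Icc (0 : ℝ) 1) := (le_gfun hP₁ hP₂ hS hδ hu).trans hg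
  have hN := hS.posSemidef.nonneg_real (Sum.elim (P₁⁻¹ *ᵥ u₁) (-(P₂⁻¹ *ᵥ u₂)))
  set N := Sum.elim (P₁⁻¹ *ᵥ u₁) (-(P₂⁻¹ *ᵥ u₂)) ⬝ᵥ
    S *ᵥ Sum.elim (P₁⁻¹ *ᵥ u₁) (-(P₂⁻¹ *ᵥ u₂))
  set M := u₁ ⬝ᵥ P₁⁻¹ *ᵥ u₁ - u₂ ⬝ᵥ P₂⁻¹ *ᵥ u₂
  have hstep {r : ℝ} (hr : 0 < r) {K : ℝ} (hK : 0 < K) :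
      ∃ δ, 0 < δ ∧ δ ≤ r ∧ δ * N < K := by
    refine ⟨min r (K / (N + 1)), lt_min hr (by positivity), min_le_left _ _, ?_⟩
    refine (mul_le_mul_of_nonneg_right (min_le_right _ _) hN).trans_lt ?_
    rw [div_mul_eq_mul_div, div_lt_iff₀ (by positivity)]
    linarith
  constructor
  · intro hM
    by_contra h
    obtain ⟨δ, hδ, hδr, hδN⟩ := hstep (sub_pos.2 (lt_of_le_of_ne hω.2 h)) hM
    nlinarith [hlow δ ⟨by linarith [hω.1], by linarith⟩]
  · intro hM
    by_contra h
    obtain ⟨δ, hδ, hδr, hδN⟩ := hstep (lt_of_le_of_ne hω.1 (Ne.symm h)) (neg_pos.2 hM)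
    nlinarith [hlow (-δ) ⟨by linarith, by linarith [hω.2]⟩]

theorem AF_le_gfun (hP₁ : P₁.PosDef) (hP₂ : P₂.PosDef) (hS : S.PosDef) (hω : ω ∈ Icc (0 : ℝ) 1)
    (x : Fin d → ℝ) : x ⬝ᵥ AF d P₁ P₂ S ω *ᵥ x ≤ gfun d P₁ P₂ S x := by
  obtain ⟨U₁, U₂, hU⟩ := exists_AF_representation hP₁ hP₂ hS hω
  simpa [(hU x).2] using le_gfun hP₁ hP₂ hS (δ := 0) (by simpa using hω) (hU x).1

/-- If `g` and the quadratic form of `A_F(ω)` touch nowhere then they are uniformly separated. -/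
theorem exists_pos_AF_add_le_gfun (hP₁ : P₁.PosDef) (hP₂ : P₂.PosDef) (hS : S.PosDef)
    (hω : ω ∈ Icc (0 : ℝ) 1)
    (h : ∀ x, x ≠ 0 → gfun d P₁ P₂ S x ≠ x ⬝ᵥ AF d P₁ P₂ S ω *ᵥ x) :
    ∃ ε : ℝ, 0 < ε ∧ ∀ x, x ⬝ᵥ AF d P₁ P₂ S ω *ᵥ x + ε * (x ⬝ᵥ x) ≤ gfun d P₁ P₂ S x := by
  obtain ⟨U₁, U₂, hU⟩ := exists_AF_representation hP₁ hP₂ hS hω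
  set M : (Fin d → ℝ) → ℝ := fun x =>
    (U₁ *ᵥ x) ⬝ᵥ P₁⁻¹ *ᵥ U₁ *ᵥ x - (U₂ *ᵥ x) ⬝ᵥ P₂⁻¹ *ᵥ U₂ *ᵥ x with hM
  set E : Matrix (Fin d ⊕ Fin d) (Fin d) ℝ := fromRows (P₁⁻¹ * U₁) (-(P₂⁻¹ * U₂)) with hE
  have hEx (x : Fin d → ℝ) :
      E *ᵥ x = Sum.elim (P₁⁻¹ *ᵥ U₁ *ᵥ x) (-(P₂⁻¹ *ᵥ U₂ *ᵥ x)) := by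
    rw [hE, fromRows_mulVec, neg_mulVec, mulVec_mulVec, mulVec_mulVec]
  have hlow (x : Fin d → ℝ) (δ : ℝ) (hδ : ω + δ ∈ Icc (0 : ℝ) 1) :
      x ⬝ᵥ AF d P₁ P₂ S ω *ᵥ x + δ * M x - δ ^ 2 * ((E *ᵥ x) ⬝ᵥ S *ᵥ E *ᵥ x) ≤
        gfun d P₁ P₂ S x := by
    rw [hEx, (hU x).2]
    exact le_gfun hP₁ hP₂ hS hδ (hU x).1
  have hdich (x : Fin d → ℝ) (hx : x ≠ 0) : (0 < M x ∧ ω < 1) ∨ (M x < 0 ∧ 0 < ω) := by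
    by_contra! hcon
    refine h x hx (le_antisymm ?_ (AF_le_gfun hP₁ hP₂ hS hω x))
    rw [(hU x).2]
    exact gfun_le_of_stationary hP₁ hP₂ hS hω (hU x).1
      (fun hpos => le_antisymm hω.2 (hcon.1 hpos)) (fun hneg => le_antisymm (hcon.2 hneg) hω.1)
  have hMc : Continuous fun x => |M x| := by fun_prop
  have hMs (t : ℝ) (x : Fin d → ℝ) : |M (t • x)| = t ^ 2 * |M x| := by
    have hMt : M (t • x) = t ^ 2 * M x := by
      simp only [hM, mulVec_smul, smul_dotProduct, dotProduct_smul, smul_eq_mul]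
      ring
    rw [hMt, abs_mul, abs_of_nonneg (sq_nonneg t)]
  have hMpos (x : Fin d → ℝ) (hx : x ≠ 0) : 0 < |M x| :=
    abs_pos.2 ((hdich x hx).elim (fun h => h.1.ne') fun h => h.1.ne)
  obtain ⟨C, hC, hCle⟩ := exists_pos_forall_le_mul_of_homogeneous hMc
    (ψ := fun x => (E *ᵥ x) ⬝ᵥ S *ᵥ E *ᵥ x) (by fun_prop) hMs
    (fun t x => by simp only [mulVec_smul, smul_dotProduct, dotProduct_smul, smul_eq_mul]; ring)
    hMpos
  obtain ⟨C', hC', hCle'⟩ := exists_pos_forall_le_mul_of_homogeneous hMc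
    (ψ := fun x => x ⬝ᵥ x) (by fun_prop) hMs
    (fun t x => by simp only [smul_dotProduct, dotProduct_smul, smul_eq_mul]; ring) hMpos
  obtain ⟨η, hη, hη₀, hη₁, hηC⟩ : ∃ η : ℝ, 0 < η ∧ (0 < ω → η ≤ ω) ∧ (ω < 1 → η ≤ 1 - ω) ∧
      η * C ≤ 1 / 2 := by
    refine ⟨min (min (if 0 < ω then ω else 1) (if ω < 1 then 1 - ω else 1)) (1 / 2 / C), ?_,
      fun h => ?_, fun h => ?_, ?_⟩
    · refine lt_min (lt_min ?_ ?_) (by positivity)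
      · split_ifs with h <;> linarith
      · split_ifs with h <;> linarith
    · exact (min_le_left _ _).trans ((min_le_left _ _).trans (by rw [if_pos h]))
    · exact (min_le_left _ _).trans ((min_le_right _ _).trans (by rw [if_pos h]))
    · rw [← le_div_iff₀ hC]
      exact min_le_right _ _
  refine ⟨η / 2 / C', by positivity, fun x => ?_⟩
  have hgap : x ⬝ᵥ AF d P₁ P₂ S ω *ᵥ x + η * |M x| - η ^ 2 * ((E *ᵥ x) ⬝ᵥ S *ᵥ E *ᵥ x) ≤
      gfun d P₁ P₂ S x := by
    by_cases hx : x = 0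
    · have := AF_le_gfun hP₁ hP₂ hS hω x
      subst hx
      simpa [hM] using this
    rcases hdich x hx with ⟨hp, hω'⟩ | ⟨hn, hω'⟩
    · rw [abs_of_pos hp]
      exact hlow x η ⟨by linarith [hω.1], by linarith [hη₁ hω']⟩
    · have := hlow x (-η) ⟨by linarith [hη₀ hω'], by linarith [hω.2]⟩
      rw [abs_of_neg hn]
      linarith
  have h₁ : η ^ 2 * ((E *ᵥ x) ⬝ᵥ S *ᵥ E *ᵥ x) ≤ η / 2 * |M x| :=
    calc _ ≤ η ^ 2 * (C * |M x|) := mul_le_mul_of_nonneg_left (hCle x) (sq_nonneg η)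
      _ = η * (η * C) * |M x| := by ring
      _ ≤ η * (1 / 2) * |M x| := by gcongr
      _ = _ := by ring
  have h₂ : η / 2 / C' * (x ⬝ᵥ x) ≤ η / 2 * |M x| :=
    calc _ ≤ η / 2 / C' * (C' * |M x|) := mul_le_mul_of_nonneg_left (hCle' x) (by positivity)
      _ = _ := by field_simp
  linarith

/-- A positive semidefinite matrix whose quadratic form is dominated by the gap between `g` and
the quadratic form of `A_F(ω)` vanishes as soon as that gap closes in one direction. -/
theorem eq_zero_of_AF_add_le_gfun (hP₁ : P₁.PosDef) (hP₂ : P₂.PosDef) (hS : S.PosDef)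
    (hω : ω ∈ Icc (0 : ℝ) 1) {x₀ : Fin d → ℝ} (hx₀ : x₀ ≠ 0)
    (htouch : gfun d P₁ P₂ S x₀ = x₀ ⬝ᵥ AF d P₁ P₂ S ω *ᵥ x₀)
    {Δ : Matrix (Fin d) (Fin d) ℝ} (hΔ : Δ.PosSemidef)
    (hle : ∀ x, x ⬝ᵥ AF d P₁ P₂ S ω *ᵥ x + x ⬝ᵥ Δ *ᵥ x ≤ gfun d P₁ P₂ S x) : Δ = 0 := by
  obtain ⟨U₁, U₂, hU⟩ := exists_AF_representation hP₁ hP₂ hS hω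
  obtain ⟨C, hC, hCle⟩ := exists_gfun_le_add_mul_sq hP₁ hP₂ hS hω
  refine hΔ.eq_zero_of_forall_dotProduct_mulVec_eq_zero fun v =>
    le_antisymm ?_ (hΔ.nonneg_real v)
  have hΔ₀ : Δ *ᵥ x₀ = 0 := (hΔ.dotProduct_mulVec_zero_iff x₀).1 <| by
    have := hle x₀
    rw [star_trivial]
    exact le_antisymm (by linarith) (hΔ.nonneg_real x₀)
  have hΔv (t : ℝ) : (v + t • x₀) ⬝ᵥ Δ *ᵥ (v + t • x₀) = v ⬝ᵥ Δ *ᵥ v := by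
    rw [dotProduct_mulVec_add_smul, hΔ.1.dotProduct_mulVec_comm_real x₀ v, hΔ₀]
    simp
  have hexp (P U : Matrix (Fin d) (Fin d) ℝ) (t : ℝ) :
      (U *ᵥ (v + t • x₀)) ⬝ᵥ P *ᵥ U *ᵥ (v + t • x₀) = (U *ᵥ v) ⬝ᵥ P *ᵥ U *ᵥ v +
        t * ((U *ᵥ v) ⬝ᵥ P *ᵥ U *ᵥ x₀ + (U *ᵥ x₀) ⬝ᵥ P *ᵥ U *ᵥ v) +
        t ^ 2 * ((U *ᵥ x₀) ⬝ᵥ P *ᵥ U *ᵥ x₀) := by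
    rw [mulVec_add, mulVec_smul, dotProduct_mulVec_add_smul]
  have hstat := stationary_of_gfun_le hP₁ hP₂ hS hω (hU x₀).1 (htouch.trans (hU x₀).2).le
  have hvanish (t : ℝ)
      (hpos : 0 < (U₁ *ᵥ (v + t • x₀)) ⬝ᵥ P₁⁻¹ *ᵥ U₁ *ᵥ (v + t • x₀) -
        (U₂ *ᵥ (v + t • x₀)) ⬝ᵥ P₂⁻¹ *ᵥ U₂ *ᵥ (v + t • x₀) → ω = 1)
      (hneg : (U₁ *ᵥ (v + t • x₀)) ⬝ᵥ P₁⁻¹ *ᵥ U₁ *ᵥ (v + t • x₀) -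
        (U₂ *ᵥ (v + t • x₀)) ⬝ᵥ P₂⁻¹ *ᵥ U₂ *ᵥ (v + t • x₀) < 0 → ω = 0) :
      v ⬝ᵥ Δ *ᵥ v ≤ 0 := by
    have h₁ := gfun_le_of_stationary hP₁ hP₂ hS hω (hU (v + t • x₀)).1 hpos hneg
    have h₂ := hle (v + t • x₀)
    rw [hΔv, (hU (v + t • x₀)).2] at h₂
    linarith
  have hf₀ : 0 < (U₁ *ᵥ x₀) ⬝ᵥ P₁⁻¹ *ᵥ U₁ *ᵥ x₀ + (U₂ *ᵥ x₀) ⬝ᵥ P₂⁻¹ *ᵥ U₂ *ᵥ x₀ := by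
    by_cases h₁ : U₁ *ᵥ x₀ = 0
    · refine add_pos_of_nonneg_of_pos (hP₁.inv.posSemidef.nonneg_real _)
        (hP₂.inv.pos_real fun h₂ => hx₀ ?_)
      have h := (hU x₀).1
      simp only [h₁, h₂, mulVec_zero, smul_zero, Sum.elim_zero_zero, add_zero] at h
      exact funext fun i => by simpa using (congrFun h (Sum.inl i)).symm
    · exact add_pos_of_pos_of_nonneg (hP₁.inv.pos_real h₁) (hP₂.inv.posSemidef.nonneg_real _)
  refine nonpos_of_mul_quadratic_le (C := C)
    (m₀ := (U₁ *ᵥ v) ⬝ᵥ P₁⁻¹ *ᵥ U₁ *ᵥ v - (U₂ *ᵥ v) ⬝ᵥ P₂⁻¹ *ᵥ U₂ *ᵥ v)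
    (m₁ := ((U₁ *ᵥ v) ⬝ᵥ P₁⁻¹ *ᵥ U₁ *ᵥ x₀ + (U₁ *ᵥ x₀) ⬝ᵥ P₁⁻¹ *ᵥ U₁ *ᵥ v) -
      ((U₂ *ᵥ v) ⬝ᵥ P₂⁻¹ *ᵥ U₂ *ᵥ x₀ + (U₂ *ᵥ x₀) ⬝ᵥ P₂⁻¹ *ᵥ U₂ *ᵥ v))
    (m₂ := (U₁ *ᵥ x₀) ⬝ᵥ P₁⁻¹ *ᵥ U₁ *ᵥ x₀ - (U₂ *ᵥ x₀) ⬝ᵥ P₂⁻¹ *ᵥ U₂ *ᵥ x₀)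
    (f₀ := (U₁ *ᵥ v) ⬝ᵥ P₁⁻¹ *ᵥ U₁ *ᵥ v + (U₂ *ᵥ v) ⬝ᵥ P₂⁻¹ *ᵥ U₂ *ᵥ v)
    (f₁ := ((U₁ *ᵥ v) ⬝ᵥ P₁⁻¹ *ᵥ U₁ *ᵥ x₀ + (U₁ *ᵥ x₀) ⬝ᵥ P₁⁻¹ *ᵥ U₁ *ᵥ v) +
      ((U₂ *ᵥ v) ⬝ᵥ P₂⁻¹ *ᵥ U₂ *ᵥ x₀ + (U₂ *ᵥ x₀) ⬝ᵥ P₂⁻¹ *ᵥ U₂ *ᵥ v))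
    hf₀ (fun t ht => ?_) (fun hm t ht => ?_) (fun hm t ht => ?_) (fun t => ?_)
  · refine hvanish t (fun h => ?_) (fun h => ?_) <;>
    · rw [hexp, hexp] at h
      linarith
  · refine hvanish t (fun h => ?_) (fun _ => hstat.2 hm)
    rw [hexp, hexp] at h
    linarith
  · refine hvanish t (fun _ => hstat.1 hm) (fun h => ?_)
    rw [hexp, hexp] at h
    linarith
  · have h₁ := hCle _ _ _ (hU (v + t • x₀)).1
    have h₂ := hle (v + t • x₀)
    rw [hΔv, (hU (v + t • x₀)).2] at h₂
    have ha := Real.sq_sqrt (hP₁.inv.posSemidef.nonneg_real (U₁ *ᵥ (v + t • x₀)))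
    have hb := Real.sq_sqrt (hP₂.inv.posSemidef.nonneg_real (U₂ *ᵥ (v + t • x₀)))
    have ha₀ := Real.sqrt_nonneg ((U₁ *ᵥ (v + t • x₀)) ⬝ᵥ P₁⁻¹ *ᵥ U₁ *ᵥ (v + t • x₀))
    have hb₀ := Real.sqrt_nonneg ((U₂ *ᵥ (v + t • x₀)) ⬝ᵥ P₂⁻¹ *ᵥ U₂ *ᵥ (v + t • x₀))
    set a := √((U₁ *ᵥ (v + t • x₀)) ⬝ᵥ P₁⁻¹ *ᵥ U₁ *ᵥ (v + t • x₀))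
    set b := √((U₂ *ᵥ (v + t • x₀)) ⬝ᵥ P₂⁻¹ *ᵥ U₂ *ᵥ (v + t • x₀))
    rw [hexp] at ha hb
    have hD : v ⬝ᵥ Δ *ᵥ v ≤ C * (a - b) ^ 2 := by linarith
    have hab : (a - b) ^ 2 * (a ^ 2 + b ^ 2) ≤ (a ^ 2 - b ^ 2) ^ 2 := by
      rw [show (a ^ 2 - b ^ 2) ^ 2 = (a - b) ^ 2 * (a + b) ^ 2 by ring]
      exact mul_le_mul_of_nonneg_left (by nlinarith [mul_nonneg ha₀ hb₀]) (sq_nonneg _)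
    have key := (mul_le_mul_of_nonneg_right hD (by positivity : 0 ≤ a ^ 2 + b ^ 2)).trans
      ((mul_assoc C _ _).trans_le (mul_le_mul_of_nonneg_left hab hC.le))
    rw [ha, hb] at key
    refine le_trans (le_of_eq ?_) (key.trans (le_of_eq ?_)) <;> ring

/-- `B_F(ω₁)` tightly circumscribes `V(𝒜)` if and only if it
touches `V(𝒜)`, i.e. `g(x) = xᵀ A_F(ω₁) x` for some `x ≠ 0`. -/
theorem esci_tight_iff_touches (d : ℕ) (hd : 1 ≤ d)
    (P₁ P₂ : Matrix (Fin d) (Fin d) ℝ) (hP₁ : P₁.PosDef) (hP₂ : P₂.PosDef)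
    (S : Matrix (Fin d ⊕ Fin d) (Fin d ⊕ Fin d) ℝ) (hS : S.PosDef)
    (ω₁ : ℝ) (hω₁ : ω₁ ∈ Set.Icc (0 : ℝ) 1) :
    TightlyCircumscribes d P₁ P₂ S (BF d P₁ P₂ S ω₁) ↔
      ∃ x : Fin d → ℝ, x ≠ 0 ∧
        gfun d P₁ P₂ S x = x ⬝ᵥ (AF d P₁ P₂ S ω₁) *ᵥ x := by
  have hA := AF_posDef hP₁ hP₂ hS hω₁
  have hBF : (BF d P₁ P₂ S ω₁)⁻¹ = AF d P₁ P₂ S ω₁ := hA.inv_inv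
  constructor
  · rintro ⟨-, -, hmin⟩
    by_contra! hno
    obtain ⟨ε, hε, hle⟩ := exists_pos_AF_add_le_gfun hP₁ hP₂ hS hω₁ hno
    have hε1 : (ε • (1 : Matrix (Fin d) (Fin d) ℝ)).PosDef := PosDef.one.smul hε
    have hAε := hA.add hε1
    have heq := hmin (AF d P₁ P₂ S ω₁ + ε • 1)⁻¹ hAε.inv
      (fun x => by
        rw [hAε.inv_inv, add_mulVec, dotProduct_add, smul_mulVec, one_mulVec, dotProduct_smul,
          smul_eq_mul]
        exact hle x)
      (hA.inv_sub_inv_posSemidef hAε (by simpa using hε1.posSemidef))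
    have h₁ : AF d P₁ P₂ S ω₁ + ε • 1 = AF d P₁ P₂ S ω₁ :=
      hAε.inv_inv.symm.trans ((congrArg (·⁻¹) heq).trans hBF)
    have h₂ := congrFun (congrFun (add_eq_left.1 h₁) ⟨0, hd⟩) ⟨0, hd⟩
    simp [hε.ne'] at h₂
  · rintro ⟨x₀, hx₀, htouch⟩
    refine ⟨hA.inv, fun x => by rw [hBF]; exact AF_le_gfun hP₁ hP₂ hS hω₁ x,
      fun Q hQ hQle hBQ => ?_⟩
    have hΔ := hQ.inv_sub_inv_posSemidef hA.inv hBQ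
    rw [hA.inv_inv] at hΔ
    have h := eq_zero_of_AF_add_le_gfun hP₁ hP₂ hS hω₁ hx₀ htouch hΔ fun x => by
      rw [sub_mulVec, dotProduct_sub, add_sub_cancel]
      exact hQle x
    rw [BF, ← sub_eq_zero.1 h, hQ.inv_inv]
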